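/- (Theorem 1, squared-bound form.) Fix d ≥ 2 and K ≥ 2, and let C_d = (3/2)(1 + log(d)/d) γ_d V_d with γ_d = 1 + d·log(d·log d) and V_d = 2 Γ(1/2)^d / (d Γ(d/2)) the volume of the d-dimensional Euclidean unit ball, and let C_p > 0 be any constant. Let μ_1, ..., μ_K be nonzero vectors in ℝ^d with mutual coherence μ(U) and u_max = max_k ‖μ_k‖. Suppose the average distortion s ≥ 0 satisfies s ≤ B, where B = C_d C_p (⌊(K/2)^{1/d}⌋^{−1} + 1) K^{−1/d}, and suppose there exist indices p ≠ q with ‖μ_p‖ = u_max and a point z ∈ ℝ^d with ‖z − μ_p‖ ≤ s and ‖z − μ_q‖ ≤ s. Then μ(U)² ≥ 1 − (4 B² / u_max²). -/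

import Mathlib

open scoped RealInnerProductSpace

/-- The squared correlation of two vectors is at least `1 - ‖x - y‖² / ‖x‖²`: the distance from `x`
to `y` is at least the distance from `x` to the line spanned by `y`. -/
theorem one_sub_norm_sub_sq_div_le_correlation_sq {E : Type*} [NormedAddCommGroup E]
    [InnerProductSpace ℝ E] {x y : E} (hx : x ≠ 0) (hy : y ≠ 0) :
    1 - ‖x - y‖ ^ 2 / ‖x‖ ^ 2 ≤ (|⟪x, y⟫| / (‖x‖ * ‖y‖)) ^ 2 := by
  have hx' : 0 < ‖x‖ := norm_pos_iff.2 hx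
  have hy' : 0 < ‖y‖ := norm_pos_iff.2 hy
  rw [div_pow, sq_abs, norm_sub_sq_real]
  have h : ⟪x, y⟫ ^ 2 / (‖x‖ * ‖y‖) ^ 2 - (1 - (‖x‖ ^ 2 - 2 * ⟪x, y⟫ + ‖y‖ ^ 2) / ‖x‖ ^ 2)
      = ((⟪x, y⟫ - ‖y‖ ^ 2) / (‖x‖ * ‖y‖)) ^ 2 := by
    field_simp
    ring
  linarith [sq_nonneg ((⟪x, y⟫ - ‖y‖ ^ 2) / (‖x‖ * ‖y‖))]

/-- Theorem 1, squared-bound form: with `C_d = (3/2)(1 + log d / d) γ_d V_d`,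
`γ_d = 1 + d log(d log d)`, `V_d = 2 Γ(1/2)^d / (d Γ(d/2))`, `C_p > 0`, and
`B = C_d C_p (⌊(K/2)^{1/d}⌋⁻¹ + 1) K^{-1/d}`: if the average distortion `s ≥ 0` satisfies
`s ≤ B`, and there are indices `p ≠ q` with `‖μ p‖ = umax` and a point `z` with
`‖z - μ p‖ ≤ s` and `‖z - μ q‖ ≤ s`, then `coh² ≥ 1 - 4 B² / umax²`. -/
theorem mutual_coherence_sq_ge_distortion_bound
    (d K : ℕ) (hd : 2 ≤ d) (hK : 2 ≤ K)
    (γd Vd Cd Cp B : ℝ)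
    (hγd : γd = 1 + (d : ℝ) * Real.log ((d : ℝ) * Real.log d))
    (hVd : Vd = 2 * Real.Gamma (1 / 2) ^ d / ((d : ℝ) * Real.Gamma ((d : ℝ) / 2)))
    (hCd : Cd = (3 / 2) * (1 + Real.log d / (d : ℝ)) * γd * Vd)
    (hCp : 0 < Cp)
    (hB : B = Cd * Cp * ((⌊((K : ℝ) / 2) ^ ((d : ℝ)⁻¹)⌋ : ℝ)⁻¹ + 1)
      * (K : ℝ) ^ (-(d : ℝ)⁻¹))
    (μ : Fin K → EuclideanSpace ℝ (Fin d))
    (hμ : ∀ k, μ k ≠ 0)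
    (coh umax : ℝ)
    (hcoh : coh = (Finset.univ.offDiag : Finset (Fin K × Fin K)).sup'
      (⟨(⟨0, by omega⟩, ⟨1, by omega⟩), Finset.mem_offDiag.2
        ⟨Finset.mem_univ _, Finset.mem_univ _, by simp [Fin.ext_iff]⟩⟩)
      (fun pq => |⟪μ pq.1, μ pq.2⟫| / (‖μ pq.1‖ * ‖μ pq.2‖)))
    (humax : umax = (Finset.univ : Finset (Fin K)).sup'
      (Finset.univ_nonempty_iff.2 ⟨⟨0, by omega⟩⟩) (fun k => ‖μ k‖))
    (s : ℝ) (hs : 0 ≤ s) (hsB : s ≤ B)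
    (p q : Fin K) (hpq : p ≠ q) (hp : ‖μ p‖ = umax)
    (z : EuclideanSpace ℝ (Fin d))
    (hzp : ‖z - μ p‖ ≤ s) (hzq : ‖z - μ q‖ ≤ s) :
    coh ^ 2 ≥ 1 - 4 * B ^ 2 / umax ^ 2 := by
  have hle : |⟪μ p, μ q⟫| / (‖μ p‖ * ‖μ q‖) ≤ coh := by
    rw [hcoh]
    exact Finset.le_sup' (fun pq : Fin K × Fin K => |⟪μ pq.1, μ pq.2⟫| / (‖μ pq.1‖ * ‖μ pq.2‖))
      (b := (p, q)) (Finset.mem_offDiag.2 ⟨Finset.mem_univ p, Finset.mem_univ q, hpq⟩)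
  have hdist : ‖μ p - μ q‖ ≤ 2 * B := by
    have := norm_sub_le_norm_sub_add_norm_sub (μ p) z (μ q)
    rw [norm_sub_rev (μ p) z] at this
    linarith
  calc 1 - 4 * B ^ 2 / umax ^ 2 = 1 - (2 * B) ^ 2 / ‖μ p‖ ^ 2 := by rw [hp]; ring
    _ ≤ 1 - ‖μ p - μ q‖ ^ 2 / ‖μ p‖ ^ 2 := by gcongr
    _ ≤ (|⟪μ p, μ q⟫| / (‖μ p‖ * ‖μ q‖)) ^ 2 :=
      one_sub_norm_sub_sq_div_le_correlation_sq (hμ p) (hμ q)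
    _ ≤ coh ^ 2 := by gcongr
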